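/- In the configuration model with n vertices each of degree d (nd even) and i.i.d. spins with law μ on [q], for any admissible type (ρ, ν) realizable at size n, the probability that (L_1, L_2) = (ρ, ν) satisfies e^{-n H(ρ||μ) - (nd/2) H(ν||ρ⊗ρ) - o(n)} ≤ P((L_1,L_2) = (ρ,ν)) ≤ e^{-n H(ρ||μ) - (nd/2) H(ν||ρ⊗ρ) + o(n)}, where the o(n) terms are O(log n) uniformly. -/

import Mathlib

open scoped Classical

/-- The set of pairings (fixed-point-free involutions) of the `N` half-edges. -/
noncomputable def pairings (N : ℕ) : Finset (Equiv.Perm (Fin N)) :=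
  Finset.univ.filter (fun f => (∀ p, f (f p) = p) ∧ ∀ p, f p ≠ p)

/-- The probability, in the spinned configuration model with `n` vertices of degree `d` and
i.i.d. spin law `μ`, of an event `A` of the spins and the pairing: uniform pairing of the
`nd` half-edges, independent spins. -/
noncomputable def configProb (q n d : ℕ) (μ : Fin q → ℝ)
    (A : (Fin n → Fin q) → Equiv.Perm (Fin (n * d)) → Prop) : ℝ :=
  (∑ f ∈ pairings (n * d), ∑ η : Fin n → Fin q,
      (∏ i, μ (η i)) * (if A η f then 1 else 0)) / (pairings (n * d)).card


/-- The entropy function `x log x - x`. -/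
noncomputable def entF (x : ℝ) : ℝ := x * Real.log x - x

lemma log_fact_lower (k : ℕ) : entF k ≤ Real.log (k.factorial : ℝ) := by
  induction k with
  | zero => simp [entF]
  | succ k ih =>
    have hf : (0:ℝ) < k.factorial := by exact_mod_cast k.factorial_pos
    have hk1 : (0:ℝ) < (k:ℝ) + 1 := by positivity
    rw [Nat.factorial_succ]
    push_cast
    rw [Real.log_mul hk1.ne' hf.ne']
    unfold entF at *
    rcases Nat.eq_zero_or_pos k with h | h
    · subst h; simp
    · have hk : (0:ℝ) < k := by exact_mod_cast h
      have h1 := Real.log_le_sub_one_of_pos (div_pos hk1 hk)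
      rw [Real.log_div hk1.ne' hk.ne'] at h1
      have h2 : (k:ℝ) * (Real.log (k+1) - Real.log k) ≤ k * (((k:ℝ)+1)/k - 1) :=
        mul_le_mul_of_nonneg_left h1 hk.le
      have h3 : (k:ℝ) * (((k:ℝ)+1)/k - 1) = 1 := by field_simp; ring
      nlinarith

lemma log_fact_upper (k : ℕ) : Real.log (k.factorial : ℝ) ≤ entF k + 1 + Real.log (k + 1) := by
  have key : ∀ k : ℕ, 1 ≤ k → Real.log (k.factorial : ℝ) ≤ entF k + 1 + Real.log k := by
    intro k hk
    induction k, hk using Nat.le_induction with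
    | base => simp [entF]
    | succ k h ih =>
      have hf : (0:ℝ) < k.factorial := by exact_mod_cast k.factorial_pos
      have hk1 : (0:ℝ) < (k:ℝ) + 1 := by positivity
      rw [Nat.factorial_succ]
      push_cast
      rw [Real.log_mul hk1.ne' hf.ne']
      unfold entF at *
      have hk : (0:ℝ) < k := by exact_mod_cast h
      have h1 := Real.one_sub_inv_le_log_of_pos (div_pos hk1 hk)
      rw [Real.log_div hk1.ne' hk.ne'] at h1
      have h2 := mul_le_mul_of_nonneg_left h1 hk1.le
      have h3 : ((k:ℝ)+1) * (1 - (((k:ℝ)+1)/k)⁻¹) = 1 := by field_simp; ring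
      nlinarith
  rcases Nat.eq_zero_or_pos k with h | h
  · subst h; simp [entF]
  · have hk : (0:ℝ) < k := by exact_mod_cast h
    have := key k h
    have := Real.log_le_log hk (by linarith : (k:ℝ) ≤ k + 1)
    linarith

lemma entF_ge (x : ℝ) (hx : 0 ≤ x) : -1 ≤ entF x := by
  unfold entF
  rcases hx.eq_or_lt with h | h
  · subst h; simp
  · have h1 := Real.one_sub_inv_le_log_of_pos h
    have h2 := mul_le_mul_of_nonneg_left h1 h.le
    have h3 : x * (1 - x⁻¹) = x - 1 := by field_simp
    linarith

lemma entF_mono (a x : ℝ) (ha : 1 ≤ a) (hx : a ≤ x) : entF a ≤ entF x := by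
  unfold entF
  have ha0 : 0 < a := by linarith
  have hx0 : 0 < x := by linarith
  have h1 := Real.one_sub_inv_le_log_of_pos (div_pos hx0 ha0)
  rw [Real.log_div hx0.ne' ha0.ne'] at h1
  have h2 := mul_le_mul_of_nonneg_left h1 hx0.le
  have h3 : x * (1 - (x/a)⁻¹) = x - a := by field_simp
  have h4 : 0 ≤ (x - a) * Real.log a := mul_nonneg (by linarith) (Real.log_nonneg ha)
  nlinarith

lemma log_fact_half_aux (a m N : ℕ) (h : 2 * a ≤ m) (hm : m ≤ N) :
    Real.log (a.factorial : ℝ) ≤ entF ((m:ℝ)/2) + (1 + Real.log (N + 1)) := by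
  have hN : 0 ≤ Real.log ((N:ℝ) + 1) := Real.log_nonneg (by linarith [Nat.cast_nonneg (α := ℝ) N])
  rcases Nat.eq_zero_or_pos a with h0 | h0
  · subst h0
    have := entF_ge ((m:ℝ)/2) (by positivity)
    simp; linarith
  · have h1 : (1:ℝ) ≤ a := by exact_mod_cast h0
    have h2 : (2:ℝ) * a ≤ m := by exact_mod_cast h
    have h3 : (m:ℝ) ≤ N := by exact_mod_cast hm
    have := entF_mono a ((m:ℝ)/2) h1 (by linarith)
    have := log_fact_upper a
    have := Real.log_le_log (by linarith : (0:ℝ) < a + 1) (by linarith : (a:ℝ) + 1 ≤ N + 1)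
    linarith

lemma log_fact_half (a m N : ℕ) (h : 2 * a ≤ m + 1) (hm : m ≤ N) :
    Real.log (a.factorial : ℝ) ≤ entF ((m:ℝ)/2) + 2 * (1 + Real.log (N + 1)) := by
  have hN : 0 ≤ Real.log ((N:ℝ) + 1) := Real.log_nonneg (by linarith [Nat.cast_nonneg (α := ℝ) N])
  rcases Nat.lt_or_ge m (2*a) with h1 | h1
  · obtain ⟨b, rfl⟩ : ∃ b, a = b + 1 := ⟨a - 1, by omega⟩
    have h2 := log_fact_half_aux b m N (by omega) hm
    have hf : (0:ℝ) < b.factorial := by exact_mod_cast b.factorial_pos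
    have hk1 : (0:ℝ) < (b:ℝ) + 1 := by positivity
    have hb : (b:ℝ) ≤ N := by exact_mod_cast (by omega : b ≤ N)
    rw [Nat.factorial_succ]
    push_cast
    rw [Real.log_mul hk1.ne' hf.ne']
    have := Real.log_le_log hk1 (by linarith : (b:ℝ) + 1 ≤ N + 1)
    linarith
  · have := log_fact_half_aux a m N h1 hm
    linarith

lemma card_perm_comp {ι α : Type*} [Fintype ι] [Fintype α] [DecidableEq ι] [DecidableEq α]
    (c c' : ι → α) (t : α → ℕ)
    (h : ∀ a, (Finset.univ.filter fun i => c i = a).card = t a)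
    (h' : ∀ a, (Finset.univ.filter fun i => c' i = a).card = t a) :
    (Finset.univ.filter fun σ : Equiv.Perm ι => c ∘ σ = c').card = ∏ a, (t a).factorial := by
  have e : ∀ a, {i // c' i = a} ≃ {i // c i = a} := fun a =>
    Fintype.equivOfCardEq (by rw [Fintype.card_subtype, Fintype.card_subtype, h, h'])
  let τ : Equiv.Perm ι := Equiv.ofFiberEquiv e
  have hτ : c ∘ τ = c' := funext fun i => Equiv.ofFiberEquiv_map e i
  have h1 := DomMulAct.stabilizer_card c
  have h2 : (Finset.univ.filter fun σ : Equiv.Perm ι => c ∘ σ = c').card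
      = Fintype.card {g : Equiv.Perm ι // c ∘ g = c} := by
    rw [Fintype.card_subtype]
    refine Finset.card_equiv (Equiv.mulRight τ⁻¹) ?_
    intro σ
    simp only [Finset.mem_filter, Finset.mem_univ, true_and, Equiv.coe_mulRight]
    rw [← hτ]
    constructor
    · intro hh; funext i
      have := congrFun hh (τ⁻¹ i)
      simpa using this
    · intro hh; funext i
      have := congrFun hh (τ i)
      simpa using this
  rw [h2, h1]
  refine Finset.prod_congr rfl fun a _ => ?_
  rw [Fintype.card_subtype, h]

lemma exists_type {ι α : Type*} [Fintype ι] [Fintype α] [DecidableEq α]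
    (t : α → ℕ) (h : ∑ a, t a = Fintype.card ι) :
    ∃ c : ι → α, ∀ a, (Finset.univ.filter fun i => c i = a).card = t a := by
  have e : ι ≃ Σ a, Fin (t a) := Fintype.equivOfCardEq (by simp [h])
  refine ⟨fun i => (e i).1, fun a => ?_⟩
  rw [← Fintype.card_subtype]
  rw [Fintype.card_congr ((e.subtypeEquiv (fun i => Iff.rfl) :
    {i // (e i).1 = a} ≃ {s : Σ a, Fin (t a) // s.1 = a}).trans (Equiv.sigmaSubtype a))]
  simp

lemma card_type {ι α : Type*} [Fintype ι] [Fintype α] [DecidableEq ι] [DecidableEq α]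
    (t : α → ℕ) (h : ∑ a, t a = Fintype.card ι) :
    (Finset.univ.filter fun c : ι → α =>
      ∀ a, (Finset.univ.filter fun i => c i = a).card = t a).card * ∏ a, (t a).factorial
      = (Fintype.card ι).factorial := by
  obtain ⟨c, hc⟩ := exists_type (ι := ι) t h
  rw [← Fintype.card_perm, ← Finset.card_univ]
  rw [Finset.card_eq_sum_card_fiberwise (f := fun σ : Equiv.Perm ι => c ∘ σ)
    (t := Finset.univ.filter fun c : ι → α =>
      ∀ a, (Finset.univ.filter fun i => c i = a).card = t a)]
  · rw [Finset.sum_congr rfl (g := fun _ => ∏ a, (t a).factorial), Finset.sum_const, smul_eq_mul]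
    intro c' hc'
    exact card_perm_comp c c' t hc (by simpa using hc')
  · intro σ _
    simp only [Finset.coe_filter, Finset.mem_univ, true_and, Set.mem_ofPred_eq]
    intro a
    rw [← hc a]
    exact Finset.card_equiv σ (by simp)

lemma pairings_isConj {N : ℕ} {f g : Equiv.Perm (Fin N)} (hf : f ∈ pairings N)
    (hg : g ∈ pairings N) : IsConj f g := by
  have key : ∀ f ∈ pairings N, f.cycleType = Multiset.replicate (N / 2) 2 := by
    intro f hf
    simp only [pairings, Finset.mem_filter, Finset.mem_univ, true_and] at hf
    have h2 : f ^ 2 = 1 := by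
      ext p; simp [pow_two, hf.1 p]
    have : Fact (Nat.Prime 2) := ⟨Nat.prime_two⟩
    have h3 := Equiv.Perm.pow_prime_eq_one_iff.1 h2
    have h4 := Multiset.eq_replicate_card.2 h3
    have h5 := f.sum_cycleType
    have h6 : f.support = Finset.univ := by
      ext p; simp [hf.2 p]
    rw [h6, h4] at h5
    simp at h5
    rw [h4]
    congr 1
    omega
  rw [Equiv.Perm.isConj_iff_cycleType_eq, key f hf, key g hg]

lemma pairings_conj {N : ℕ} {f : Equiv.Perm (Fin N)} (hf : f ∈ pairings N)
    (σ : Equiv.Perm (Fin N)) : σ * f * σ⁻¹ ∈ pairings N := by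
  simp only [pairings, Finset.mem_filter, Finset.mem_univ, true_and] at *
  refine ⟨fun p => by simp [hf.1], fun p hp => hf.2 (σ⁻¹ p) ?_⟩
  have := congrArg (σ⁻¹ ·) hp
  simpa using this

lemma pairings_count {N : ℕ} {f₀ : Equiv.Perm (Fin N)} (hf : f₀ ∈ pairings N)
    (Q : Equiv.Perm (Fin N) → Prop) :
    ((pairings N).filter Q).card * N.factorial
      = (Finset.univ.filter fun σ : Equiv.Perm (Fin N) => Q (σ * f₀ * σ⁻¹)).card
        * (pairings N).card := by
  have hZ : ∀ f ∈ pairings N, (Finset.univ.filter fun σ : Equiv.Perm (Fin N) =>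
      σ * f₀ * σ⁻¹ = f).card = (Finset.univ.filter fun σ : Equiv.Perm (Fin N) =>
      σ * f₀ * σ⁻¹ = f₀).card := by
    intro f hf'
    obtain ⟨τ, hτ⟩ := isConj_iff.1 (pairings_isConj hf hf')
    refine Finset.card_equiv (Equiv.mulLeft τ⁻¹) ?_
    intro σ
    simp only [Finset.mem_filter, Finset.mem_univ, true_and, Equiv.coe_mulLeft]
    rw [← hτ]
    constructor
    · intro h
      calc τ⁻¹ * σ * f₀ * (τ⁻¹ * σ)⁻¹ = τ⁻¹ * (σ * f₀ * σ⁻¹) * τ := by group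
        _ = f₀ := by rw [h]; group
    · intro h
      calc σ * f₀ * σ⁻¹ = τ * (τ⁻¹ * σ * f₀ * (τ⁻¹ * σ)⁻¹) * τ⁻¹ := by group
        _ = _ := by rw [h]
  set Z := (Finset.univ.filter fun σ : Equiv.Perm (Fin N) => σ * f₀ * σ⁻¹ = f₀).card
  have hQ : ∀ Q : Equiv.Perm (Fin N) → Prop,
      (Finset.univ.filter fun σ : Equiv.Perm (Fin N) => Q (σ * f₀ * σ⁻¹)).card
        = ((pairings N).filter Q).card * Z := by
    intro Q
    rw [Finset.card_eq_sum_card_fiberwise (f := fun σ : Equiv.Perm (Fin N) => σ * f₀ * σ⁻¹)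
      (t := (pairings N).filter Q)]
    · rw [Finset.sum_congr rfl (g := fun _ => Z), Finset.sum_const, smul_eq_mul]
      intro f hf'
      rw [Finset.mem_filter] at hf'
      rw [← hZ f hf'.1]
      congr 1
      ext σ
      simp only [Finset.mem_filter, Finset.mem_univ, true_and]
      constructor
      · exact fun h => h.2
      · exact fun h => ⟨h ▸ hf'.2, h⟩
    · intro σ hσ
      simp only [Finset.coe_filter, Finset.mem_univ, true_and, Set.mem_ofPred_eq] at hσ ⊢
      exact ⟨pairings_conj hf σ, hσ⟩
  have h1 := hQ (fun _ => True)
  simp only [Finset.filter_true, Finset.card_univ, Fintype.card_perm, Fintype.card_fin] at h1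
  rw [hQ Q, h1]
  ring

lemma sigma_count {N q : ℕ} (f₀ : Equiv.Perm (Fin N)) (c : Fin N → Fin q)
    (t : Fin q → ℕ) (m : Fin q → Fin q → ℕ)
    (hc : ∀ a, (Finset.univ.filter fun i => c i = a).card = t a)
    (hm : ∀ y, ∑ x, m y x = t y) :
    (Finset.univ.filter fun σ : Equiv.Perm (Fin N) =>
      ∀ y x, (Finset.univ.filter fun p => c p = y ∧ c ((σ * f₀ * σ⁻¹) p) = x).card = m y x).card
    = (Finset.univ.filter fun c' : Fin N → Fin q =>
      ∀ y x, (Finset.univ.filter fun p => c' p = y ∧ c' (f₀ p) = x).card = m y x).card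
      * ∏ a, (t a).factorial := by
  have hσ : ∀ (σ : Equiv.Perm (Fin N)) y x,
      (Finset.univ.filter fun p => c p = y ∧ c ((σ * f₀ * σ⁻¹) p) = x).card
      = (Finset.univ.filter fun p => (c ∘ σ) p = y ∧ (c ∘ σ) (f₀ p) = x).card := by
    intro σ y x
    refine Finset.card_equiv σ⁻¹ fun i => ?_
    simp only [Finset.mem_filter, Finset.mem_univ, true_and]
    simp
  simp only [hσ]
  rw [Finset.card_eq_sum_card_fiberwise (f := fun σ : Equiv.Perm (Fin N) => c ∘ σ)
      (t := Finset.univ.filter fun c' : Fin N → Fin q =>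
      ∀ y x, (Finset.univ.filter fun p => c' p = y ∧ c' (f₀ p) = x).card = m y x)]
  · rw [Finset.sum_congr rfl (g := fun _ => ∏ a, (t a).factorial), Finset.sum_const, smul_eq_mul]
    intro c' hc'
    rw [Finset.mem_filter] at hc'
    rw [← card_perm_comp c c' t hc]
    · congr 1
      ext σ
      simp only [Finset.mem_filter, Finset.mem_univ, true_and]
      constructor
      · exact fun h => h.2
      · exact fun h => ⟨h ▸ hc'.2, h⟩
    · intro y
      rw [← hm y, Finset.card_eq_sum_card_fiberwise (f := fun p => c' (f₀ p)) (t := Finset.univ)]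
      · refine Finset.sum_congr rfl fun x _ => ?_
        rw [← hc'.2 y x, Finset.filter_filter]
      · intro p _; simp
  · intro σ h
    simpa using h

lemma exists_ref_pairing (N K : ℕ) (hN : N = 2 * K) (q : ℕ) (m : Fin q → Fin q → ℕ) :
    ∃ f₀ ∈ pairings N,
    (Finset.univ.filter fun c' : Fin N → Fin q =>
      ∀ y x, (Finset.univ.filter fun p => c' p = y ∧ c' (f₀ p) = x).card = m y x).card
    = (Finset.univ.filter fun g : Fin K → Fin q × Fin q =>
      ∀ y x, (Finset.univ.filter fun k => g k = (y, x)).card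
        + (Finset.univ.filter fun k => g k = (x, y)).card = m y x).card := by
  have e : Fin K × Bool ≃ Fin N := Fintype.equivOfCardEq (by simp [hN, mul_comm])
  let s : Equiv.Perm (Fin K × Bool) :=
    ⟨fun z => (z.1, !z.2), fun z => (z.1, !z.2), fun z => by simp, fun z => by simp⟩
  let f₀ : Equiv.Perm (Fin N) := (e.symm.trans s).trans e
  have hf₀ : ∀ k b, f₀ (e (k, b)) = e (k, !b) := by
    intro k b; simp [f₀, s]
  refine ⟨f₀, ?_, ?_⟩
  · simp only [pairings, Finset.mem_filter, Finset.mem_univ, true_and]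
    constructor
    · intro p
      obtain ⟨⟨k, b⟩, rfl⟩ := e.surjective p
      simp [hf₀]
    · intro p
      obtain ⟨⟨k, b⟩, rfl⟩ := e.surjective p
      simp [hf₀]
  · let Φ : (Fin N → Fin q) ≃ (Fin K → Fin q × Fin q) :=
      { toFun := fun c k => (c (e (k, false)), c (e (k, true)))
        invFun := fun g p => if (e.symm p).2 then (g (e.symm p).1).2 else (g (e.symm p).1).1
        left_inv := by
          intro c; funext p
          obtain ⟨⟨k, b⟩, rfl⟩ := e.surjective p
          cases b <;> simp
        right_inv := by
          intro g; funext k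
          simp }
    refine Finset.card_equiv Φ fun c => ?_
    simp only [Finset.mem_filter, Finset.mem_univ, true_and]
    refine forall_congr' fun y => forall_congr' fun x => ?_
    have : (Finset.univ.filter fun p => c p = y ∧ c (f₀ p) = x).card
        = (Finset.univ.filter fun k => Φ c k = (y, x)).card
        + (Finset.univ.filter fun k => Φ c k = (x, y)).card := by
      simp only [Finset.card_filter]
      rw [← e.sum_comp, Fintype.sum_prod_type, ← Finset.sum_add_distrib]
      refine Finset.sum_congr rfl fun k _ => ?_
      rw [Fintype.sum_bool]
      simp only [hf₀, Φ, Equiv.coe_fn_mk, Prod.mk.injEq, Bool.not_true, Bool.not_false]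
      rw [add_comm]
      congr 1
      simp only [and_comm]
    rw [this]

lemma symm_upper {q K : ℕ} (ν : Fin q × Fin q → ℝ) (m : Fin q → Fin q → ℕ)
    (h0 : ∀ a, 0 ≤ ν a) (h1 : ∑ a, ν a = 1) (hs : ∀ i j, ν (i, j) = ν (j, i))
    (hm : ∀ y x, (m y x : ℝ) = 2 * K * ν (y, x)) :
    ((Finset.univ.filter fun g : Fin K → Fin q × Fin q =>
      ∀ y x, (Finset.univ.filter fun k => g k = (y, x)).card
        + (Finset.univ.filter fun k => g k = (x, y)).card = m y x).card : ℝ)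
      * Real.exp (K * ∑ a, ν a * Real.log (ν a)) ≤ 1 := by
  set S := (Finset.univ.filter fun g : Fin K → Fin q × Fin q =>
      ∀ y x, (Finset.univ.filter fun k => g k = (y, x)).card
        + (Finset.univ.filter fun k => g k = (x, y)).card = m y x) with hS
  have htot : ∑ g : Fin K → Fin q × Fin q, ∏ k, ν (g k) = 1 := by
    rw [← Fintype.prod_sum (fun (_ : Fin K) a => ν a)]
    simp [h1]
  have hg : ∀ g ∈ S, ∏ k, ν (g k) = Real.exp (K * ∑ a, ν a * Real.log (ν a)) := by
    intro g hg
    simp only [hS, Finset.mem_filter, Finset.mem_univ, true_and] at hg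
    have hpos : ∀ k, 0 < ν (g k) := by
      intro k
      refine lt_of_le_of_ne (h0 _) fun h => ?_
      have h2 := hm (g k).1 (g k).2
      rw [Prod.mk.eta, ← h, ← hg] at h2
      have h3 : 0 < (Finset.univ.filter fun k' => g k' = ((g k).1, (g k).2)).card :=
        Finset.card_pos.2 ⟨k, by simp⟩
      have h4 : (0:ℝ) < (Finset.univ.filter fun k' => g k' = ((g k).1, (g k).2)).card := by
        exact_mod_cast h3
      push_cast at h2
      have h5 : (0:ℝ) ≤ (Finset.univ.filter fun k' => g k' = ((g k).2, (g k).1)).card :=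
        Nat.cast_nonneg _
      linarith
    rw [← Real.exp_log (Finset.prod_pos fun k _ => hpos k), Real.log_prod (fun k _ => (hpos k).ne')]
    congr 1
    have e1 : ∑ k, Real.log (ν (g k))
        = ∑ a, ((Finset.univ.filter fun k => g k = a).card : ℝ) * Real.log (ν a) := by
      rw [← Finset.sum_fiberwise Finset.univ g]
      refine Finset.sum_congr rfl fun a _ => ?_
      rw [Finset.sum_congr rfl (g := fun _ => Real.log (ν a)), Finset.sum_const, nsmul_eq_mul]
      intro k hk
      simp only [Finset.mem_filter, Finset.mem_univ, true_and] at hk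
      rw [hk]
    have e2 : ∑ a, ((Finset.univ.filter fun k => g k = a).card : ℝ) * Real.log (ν a)
        = ∑ a : Fin q × Fin q,
          ((Finset.univ.filter fun k => g k = a.swap).card : ℝ) * Real.log (ν a) := by
      rw [← (Equiv.prodComm (Fin q) (Fin q)).sum_comp]
      refine Finset.sum_congr rfl fun a _ => ?_
      simp only [Equiv.prodComm_apply]
      rw [show ν a.swap = ν a from hs _ _]
      rfl
    have e3 : ∑ a, ((Finset.univ.filter fun k => g k = a).card : ℝ) * Real.log (ν a)
        + ∑ a : Fin q × Fin q,
          ((Finset.univ.filter fun k => g k = a.swap).card : ℝ) * Real.log (ν a)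
        = 2 * (K * ∑ a, ν a * Real.log (ν a)) := by
      rw [← Finset.sum_add_distrib, Finset.mul_sum, Finset.mul_sum]
      refine Finset.sum_congr rfl fun a _ => ?_
      have h6 := hm a.1 a.2
      rw [← hg a.1 a.2] at h6
      push_cast at h6
      rw [← add_mul]
      have h7 : ((Finset.univ.filter fun k => g k = a).card : ℝ)
        + ((Finset.univ.filter fun k => g k = a.swap).card : ℝ) = 2 * K * ν a := h6
      rw [h7]; ring
    linarith
  calc (S.card : ℝ) * Real.exp (K * ∑ a, ν a * Real.log (ν a))
      = ∑ g ∈ S, ∏ k, ν (g k) := by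
        rw [Finset.sum_congr rfl hg, Finset.sum_const, nsmul_eq_mul]
    _ ≤ ∑ g : Fin K → Fin q × Fin q, ∏ k, ν (g k) :=
        Finset.sum_le_sum_of_subset_of_nonneg (Finset.subset_univ _)
          (fun g _ _ => Finset.prod_nonneg fun k _ => h0 _)
    _ = 1 := htot

lemma symm_lower {q K : ℕ} (m : Fin q → Fin q → ℕ) (hs : ∀ i j, m i j = m j i)
    (hd : ∀ i, Even (m i i)) (hK : ∑ y, ∑ x, m y x = 2 * K) :
    0 < (Finset.univ.filter fun g : Fin K → Fin q × Fin q =>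
      ∀ y x, (Finset.univ.filter fun k => g k = (y, x)).card
        + (Finset.univ.filter fun k => g k = (x, y)).card = m y x).card ∧
    entF K - ∑ y, ∑ x, (entF ((m y x : ℝ) / 2) + 2 * (1 + Real.log ((2 * K : ℕ) + 1))) ≤
    Real.log ((Finset.univ.filter fun g : Fin K → Fin q × Fin q =>
      ∀ y x, (Finset.univ.filter fun k => g k = (y, x)).card
        + (Finset.univ.filter fun k => g k = (x, y)).card = m y x).card : ℝ) := by
  let a : Fin q × Fin q → ℕ := fun z => if z.1 ≤ z.2 then m z.1 z.2 / 2 else m z.1 z.2 - m z.1 z.2 / 2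
  have ha : ∀ y x, a (y, x) + a (x, y) = m y x := by
    intro y x
    have h1 := hs y x
    simp only [a]
    rcases lt_trichotomy y x with h | h | h
    · rw [if_pos h.le, if_neg (not_le.2 h)]; omega
    · subst h
      have := hd y
      simp only [le_refl, if_true]
      obtain ⟨r, hr⟩ := this
      omega
    · rw [if_neg (not_le.2 h), if_pos h.le]; omega
  have ha2 : ∀ y x, 2 * a (y, x) ≤ m y x + 1 := by
    intro y x
    simp only [a]
    split_ifs <;> omega
  have hsum : ∑ z, a z = Fintype.card (Fin K) := by
    rw [Fintype.card_fin]
    have h1 : ∑ z, a z = ∑ y, ∑ x, a (y, x) := Fintype.sum_prod_type _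
    have h2 : ∑ y, ∑ x, a (y, x) = ∑ y, ∑ x, a (x, y) := Finset.sum_comm
    have h3 : ∑ y, ∑ x, a (y, x) + ∑ y, ∑ x, a (x, y) = ∑ y, ∑ x, m y x := by
      simp only [← Finset.sum_add_distrib, ha]
    omega
  have hT := card_type (ι := Fin K) a hsum
  rw [Fintype.card_fin] at hT
  set T := (Finset.univ.filter fun c : Fin K → Fin q × Fin q =>
      ∀ z, (Finset.univ.filter fun i => c i = z).card = a z) with hTdef
  set S := (Finset.univ.filter fun g : Fin K → Fin q × Fin q =>
      ∀ y x, (Finset.univ.filter fun k => g k = (y, x)).card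
        + (Finset.univ.filter fun k => g k = (x, y)).card = m y x) with hSdef
  have hTS : T ⊆ S := by
    intro g hg
    simp only [hTdef, hSdef, Finset.mem_filter, Finset.mem_univ, true_and] at hg ⊢
    intro y x
    rw [hg, hg, ha]
  have hTpos : 0 < T.card := by
    rcases Nat.eq_zero_or_pos T.card with h | h
    · rw [h, zero_mul] at hT
      exact absurd hT.symm (Nat.factorial_ne_zero K)
    · exact h
  have hle := Finset.card_le_card hTS
  refine ⟨by omega, ?_⟩
  have hTpos' : (0:ℝ) < T.card := by exact_mod_cast hTpos
  have h1 : Real.log (T.card : ℝ) ≤ Real.log (S.card : ℝ) :=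
    Real.log_le_log hTpos' (by exact_mod_cast hle)
  have h2 : Real.log (T.card : ℝ) + ∑ z, Real.log ((a z).factorial : ℝ)
      = Real.log (K.factorial : ℝ) := by
    have hne : ∀ z ∈ Finset.univ, ((a z).factorial : ℝ) ≠ 0 := fun z _ => by
      exact_mod_cast Nat.factorial_ne_zero _
    rw [← Real.log_prod hne, ← Real.log_mul hTpos'.ne' (Finset.prod_ne_zero_iff.2 hne), ← hT]
    push_cast
    rfl
  have h3 := log_fact_lower K
  have h4 : ∑ z, Real.log ((a z).factorial : ℝ)
      ≤ ∑ y, ∑ x, (entF ((m y x : ℝ) / 2) + 2 * (1 + Real.log ((2 * K : ℕ) + 1))) := by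
    rw [Fintype.sum_prod_type]
    refine Finset.sum_le_sum fun y _ => Finset.sum_le_sum fun x _ => ?_
    refine log_fact_half _ _ _ (ha2 y x) ?_
    rw [← hK]
    exact (Finset.single_le_sum (f := fun x => m y x) (fun _ _ => Nat.zero_le _) (Finset.mem_univ x)).trans
      (Finset.single_le_sum (f := fun y => ∑ x, m y x) (fun _ _ => Nat.zero_le _) (Finset.mem_univ y))
  linarith

lemma card_halfedges {q n d : ℕ} (η : Fin n → Fin q) (y : Fin q) :
    (Finset.univ.filter fun p : Fin (n * d) =>
      η ⟨p.val / d, Nat.div_lt_of_lt_mul (Nat.mul_comm n d ▸ p.isLt)⟩ = y).card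
    = d * (Finset.univ.filter fun i => η i = y).card := by
  simp only [Finset.card_filter]
  rw [← (finProdFinEquiv (m := n) (n := d)).sum_comp, Fintype.sum_prod_type, Finset.mul_sum]
  refine Finset.sum_congr rfl fun i _ => ?_
  rw [Finset.sum_congr rfl (g := fun _ => if η i = y then 1 else 0)]
  · simp
  · intro j _
    have hd : 0 < d := j.pos
    have : (⟨(finProdFinEquiv (i, j)).val / d,
        Nat.div_lt_of_lt_mul (Nat.mul_comm n d ▸ (finProdFinEquiv (i, j)).isLt)⟩ : Fin n) = i := by
      ext
      simp [Nat.add_mul_div_left _ _ hd, Nat.div_eq_of_lt j.isLt]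
    rw [this]

lemma configProb_eq (q n d K : ℕ) (μ : Fin q → ℝ) (nn : Fin q → ℕ) (m : Fin q → Fin q → ℕ)
    (hK : n * d = 2 * K) (hrow : ∀ y, ∑ x, m y x = d * nn y) :
    configProb q n d μ (fun η f =>
            (∀ y, (Finset.univ.filter fun i => η i = y).card = nn y) ∧
            (∀ y x, (Finset.univ.filter fun p : Fin (n * d) =>
                η ⟨p.val / d, Nat.div_lt_of_lt_mul (Nat.mul_comm n d ▸ p.isLt)⟩ = y ∧
                η ⟨(f p).val / d, Nat.div_lt_of_lt_mul (Nat.mul_comm n d ▸ (f p).isLt)⟩ = x).card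
              = m y x))
      * ((n * d).factorial : ℝ)
    = ((Finset.univ.filter fun c : Fin n → Fin q =>
        ∀ a, (Finset.univ.filter fun i => c i = a).card = nn a).card : ℝ) * (∏ y, μ y ^ nn y) *
      (((Finset.univ.filter fun g : Fin K → Fin q × Fin q =>
      ∀ y x, (Finset.univ.filter fun k => g k = (y, x)).card
        + (Finset.univ.filter fun k => g k = (x, y)).card = m y x).card : ℝ)
        * ∏ y, ((d * nn y).factorial : ℝ)) := by
  obtain ⟨f₀, hf₀, hS⟩ := exists_ref_pairing (n * d) K hK q m
  have hpos : (0:ℝ) < (pairings (n * d)).card := by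
    exact_mod_cast Finset.card_pos.2 ⟨f₀, hf₀⟩
  set S' := (Finset.univ.filter fun g : Fin K → Fin q × Fin q =>
      ∀ y x, (Finset.univ.filter fun k => g k = (y, x)).card
        + (Finset.univ.filter fun k => g k = (x, y)).card = m y x) with hS'
  set T := (Finset.univ.filter fun c : Fin n → Fin q =>
        ∀ a, (Finset.univ.filter fun i => c i = a).card = nn a) with hT
  unfold configProb
  rw [div_mul_eq_mul_div, div_eq_iff hpos.ne', Finset.sum_comm, Finset.sum_mul]
  have hη : ∀ η ∈ T, (∑ f ∈ pairings (n * d), (∏ i, μ (η i)) * (if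
            ((∀ y, (Finset.univ.filter fun i => η i = y).card = nn y) ∧
            (∀ y x, (Finset.univ.filter fun p : Fin (n * d) =>
                η ⟨p.val / d, Nat.div_lt_of_lt_mul (Nat.mul_comm n d ▸ p.isLt)⟩ = y ∧
                η ⟨(f p).val / d, Nat.div_lt_of_lt_mul (Nat.mul_comm n d ▸ (f p).isLt)⟩ = x).card
              = m y x)) then (1:ℝ) else 0)) * ((n * d).factorial : ℝ)
      = (∏ y, μ y ^ nn y) * ((S'.card : ℝ) * ∏ y, ((d * nn y).factorial : ℝ))
        * (pairings (n * d)).card := by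
    intro η hη
    have hη' : ∀ a, (Finset.univ.filter fun i => η i = a).card = nn a := by
      simpa [hT] using hη
    have hμ : ∏ i, μ (η i) = ∏ y, μ y ^ nn y := by
      rw [← Finset.prod_fiberwise Finset.univ η]
      refine Finset.prod_congr rfl fun y _ => ?_
      rw [← hη' y, Finset.prod_congr rfl (g := fun _ => μ y), Finset.prod_const]
      intro i hi
      simp only [Finset.mem_filter, Finset.mem_univ, true_and] at hi
      rw [hi]
    let c : Fin (n * d) → Fin q := fun p =>
      η ⟨p.val / d, Nat.div_lt_of_lt_mul (Nat.mul_comm n d ▸ p.isLt)⟩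
    have hc : ∀ a, (Finset.univ.filter fun p => c p = a).card = d * nn a := by
      intro a
      rw [← hη' a]
      exact card_halfedges η a
    have h1 := pairings_count hf₀ (fun f => ∀ y x,
      (Finset.univ.filter fun p => c p = y ∧ c (f p) = x).card = m y x)
    have h2 := sigma_count f₀ c (fun y => d * nn y) m hc hrow
    rw [hS] at h2
    have h3 : (((pairings (n * d)).filter (fun f => ∀ y x,
      (Finset.univ.filter fun p => c p = y ∧ c (f p) = x).card = m y x)).card : ℝ)
        * ((n * d).factorial : ℝ)
        = ((S'.card : ℝ) * ∏ y, ((d * nn y).factorial : ℝ)) * (pairings (n * d)).card := by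
      have h4 : ((pairings (n * d)).filter (fun f => ∀ y x,
          (Finset.univ.filter fun p => c p = y ∧ c (f p) = x).card = m y x)).card
          * (n * d).factorial
          = (S'.card * ∏ y, (d * nn y).factorial) * (pairings (n * d)).card := by
        rw [← h2]
        convert h1
      exact_mod_cast h4
    rw [← Finset.mul_sum, hμ, mul_assoc, mul_assoc, ← h3]
    congr 2
    rw [Finset.card_filter]
    push_cast
    refine Finset.sum_congr rfl fun f _ => ?_
    refine if_congr ?_ rfl rfl
    exact ⟨fun h => h.2, fun h => ⟨hη', h⟩⟩
  have hη0 : ∀ η ∉ T, (∑ f ∈ pairings (n * d), (∏ i, μ (η i)) * (if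
            ((∀ y, (Finset.univ.filter fun i => η i = y).card = nn y) ∧
            (∀ y x, (Finset.univ.filter fun p : Fin (n * d) =>
                η ⟨p.val / d, Nat.div_lt_of_lt_mul (Nat.mul_comm n d ▸ p.isLt)⟩ = y ∧
                η ⟨(f p).val / d, Nat.div_lt_of_lt_mul (Nat.mul_comm n d ▸ (f p).isLt)⟩ = x).card
              = m y x)) then (1:ℝ) else 0)) * ((n * d).factorial : ℝ) = 0 := by
    intro η hη
    rw [Finset.sum_eq_zero, zero_mul]
    intro f _
    rw [if_neg, mul_zero]
    intro h
    exact hη (by simp [hT]; exact h.1)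
  have hfin := Finset.sum_subset (Finset.subset_univ T) (fun η _ h => hη0 η h)
  rw [Finset.sum_congr rfl hη, Finset.sum_const, nsmul_eq_mul] at hfin
  rw [mul_assoc, mul_assoc, ← mul_assoc (∏ y, μ y ^ nn y), hfin]
  refine Finset.sum_congr rfl fun η _ => ?_
  congr 1
  refine Finset.sum_congr rfl fun f _ => ?_
  congr!

lemma entF_scale {α : Type*} [Fintype α] (w : α → ℝ) (h0 : ∀ a, 0 ≤ w a) (h1 : ∑ a, w a = 1)
    (c : ℝ) (hc : 0 < c) :
    entF c - ∑ a, entF (c * w a) = -c * ∑ a, w a * Real.log (w a) := by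
  have h : ∀ a, entF (c * w a) = (entF c) * w a + c * (w a * Real.log (w a)) := by
    intro a
    unfold entF
    rcases (h0 a).eq_or_lt with h | h
    · rw [← h]; simp
    · rw [Real.log_mul hc.ne' h.ne']; ring
  simp only [h, Finset.sum_add_distrib, ← Finset.mul_sum, h1]
  ring

set_option maxHeartbeats 1000000 in
theorem stmt13 {q : ℕ} (μ : Fin q → ℝ) (hμ0 : ∀ i, 0 < μ i) (hμ1 : ∑ i, μ i = 1)
    (d : ℕ) (hd : 1 ≤ d) :
    ∃ C > (0:ℝ), ∀ n : ℕ, 2 ≤ n → Even (n * d) →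
      ∀ ρ : Fin q → ℝ, ∀ ν : Fin q × Fin q → ℝ,
        (∀ i, 0 ≤ ρ i) → (∑ i, ρ i = 1) → (∀ a, 0 ≤ ν a) →
        (∀ i j, ν (i, j) = ν (j, i)) → (∀ i, ∑ j, ν (i, j) = ρ i) →
        (∀ i, ∃ k : ℕ, (k : ℝ) = n * ρ i) →
        (∀ a, ∃ k : ℕ, (k : ℝ) = (n * d) * ν a) →
        (∀ i, ∃ k : ℕ, ((2 * k : ℕ) : ℝ) = (n * d) * ν (i, i)) →
        |Real.log (configProb q n d μ (fun η f =>
            (∀ y, ((Finset.univ.filter fun i => η i = y).card : ℝ) = n * ρ y) ∧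
            (∀ y x, ((Finset.univ.filter fun p : Fin (n * d) =>
                η ⟨p.val / d, Nat.div_lt_of_lt_mul (Nat.mul_comm n d ▸ p.isLt)⟩ = y ∧
                η ⟨(f p).val / d, Nat.div_lt_of_lt_mul (Nat.mul_comm n d ▸ (f p).isLt)⟩ = x).card : ℝ)
              = (n * d) * ν (y, x))))
          - (-(n : ℝ) * (∑ i, ρ i * Real.log (ρ i / μ i))
              - ((n : ℝ) * d) / 2 *
                ∑ i, ∑ j, ν (i, j) * Real.log (ν (i, j) / (ρ i * ρ j)))|
          ≤ C * Real.log n := by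
  have hl2 : 0 < Real.log 2 := Real.log_pos (by norm_num)
  have hld : 0 ≤ Real.log ((d:ℝ) + 1) :=
    Real.log_nonneg (by linarith [Nat.cast_nonneg (α := ℝ) d])
  refine ⟨(1 + q + 2 * q ^ 2) * (1 + (1 + Real.log ((d:ℝ) + 1)) / Real.log 2), by positivity, ?_⟩
  intro n hn heven ρ ν hρ0 hρ1 hν0 hνs hνρ hnn hmm hdd
  obtain ⟨K, hK⟩ := heven.two_dvd
  choose nn hnn using hnn
  choose m' hm' using hmm
  have hnpos : (0:ℝ) < n := by exact_mod_cast (by omega : 0 < n)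
  have hn2 : (2:ℝ) ≤ n := by exact_mod_cast hn
  have hd1 : (1:ℝ) ≤ d := by exact_mod_cast hd
  have hKr : (n:ℝ) * d = 2 * K := by exact_mod_cast hK
  have hKpos : (0:ℝ) < K := by nlinarith
  let m : Fin q → Fin q → ℕ := fun y x => m' (y, x)
  have hm : ∀ y x, (m y x : ℝ) = (n * d) * ν (y, x) := fun y x => hm' (y, x)
  have hν1 : ∑ a, ν a = 1 := by
    rw [Fintype.sum_prod_type]; simp only [hνρ, hρ1]
  have hms : ∀ i j, m i j = m j i := by
    intro i j
    have : (m i j : ℝ) = m j i := by rw [hm, hm, hνs]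
    exact_mod_cast this
  have hmd : ∀ i, Even (m i i) := by
    intro i
    obtain ⟨k, hk⟩ := hdd i
    rw [← hm] at hk
    have : 2 * k = m i i := by exact_mod_cast hk
    exact ⟨k, by omega⟩
  have hrow : ∀ y, ∑ x, m y x = d * nn y := by
    intro y
    have : ((∑ x, m y x : ℕ) : ℝ) = ((d * nn y : ℕ) : ℝ) := by
      push_cast
      simp only [hm, ← Finset.mul_sum, hνρ, hnn]
      ring
    exact_mod_cast this
  have hnsum : ∑ y, nn y = n := by
    have : ((∑ y, nn y : ℕ) : ℝ) = n := by
      push_cast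
      simp only [hnn, ← Finset.mul_sum, hρ1, mul_one]
    exact_mod_cast this
  have hmsum : ∑ y, ∑ x, m y x = 2 * K := by
    simp only [hrow, ← Finset.mul_sum, hnsum]
    rw [mul_comm, hK]
  -- the probability
  have hP := configProb_eq q n d K μ nn m hK hrow
  simp only [← hnn, ← hm, Nat.cast_inj]
  set P := configProb q n d μ (fun η f =>
            (∀ y, (Finset.univ.filter fun i => η i = y).card = nn y) ∧
            (∀ y x, (Finset.univ.filter fun p : Fin (n * d) =>
                η ⟨p.val / d, Nat.div_lt_of_lt_mul (Nat.mul_comm n d ▸ p.isLt)⟩ = y ∧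
                η ⟨(f p).val / d, Nat.div_lt_of_lt_mul (Nat.mul_comm n d ▸ (f p).isLt)⟩ = x).card
              = m y x)) with hPdef
  obtain ⟨hSpos, hSlow⟩ := symm_lower (K := K) m hms hmd hmsum
  have hSup := symm_upper (K := K) ν m hν0 hν1 hνs (fun y x => by rw [hm, hKr])
  set S' := (Finset.univ.filter fun g : Fin K → Fin q × Fin q =>
      ∀ y x, (Finset.univ.filter fun k => g k = (y, x)).card
        + (Finset.univ.filter fun k => g k = (x, y)).card = m y x) with hS'
  set T := (Finset.univ.filter fun c : Fin n → Fin q =>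
        ∀ a, (Finset.univ.filter fun i => c i = a).card = nn a) with hTdef
  have hT : T.card * ∏ a, (nn a).factorial = n.factorial := by
    have h := card_type (ι := Fin n) nn (by rw [hnsum, Fintype.card_fin])
    rw [Fintype.card_fin] at h
    rw [← h]
    congr!
  have hTpos : 0 < T.card := by
    rcases Nat.eq_zero_or_pos T.card with h | h
    · rw [h, zero_mul] at hT
      exact absurd hT.symm (Nat.factorial_ne_zero n)
    · exact h
  have hTpos' : (0:ℝ) < T.card := by exact_mod_cast hTpos
  have hSpos' : (0:ℝ) < S'.card := by exact_mod_cast hSpos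
  have hfp : ∀ k : ℕ, (0:ℝ) < (k.factorial : ℝ) := fun k => by exact_mod_cast k.factorial_pos
  have hTlog : Real.log (T.card : ℝ) + ∑ y, Real.log ((nn y).factorial : ℝ)
      = Real.log (n.factorial : ℝ) := by
    rw [← Real.log_prod (fun y _ => (hfp _).ne'),
      ← Real.log_mul hTpos'.ne' (Finset.prod_pos fun y _ => hfp _).ne', ← hT]
    push_cast
    rfl
  have hμp : (0:ℝ) < ∏ y, μ y ^ nn y := Finset.prod_pos fun y _ => pow_pos (hμ0 y) _
  have hdp : (0:ℝ) < ∏ y, ((d * nn y).factorial : ℝ) := Finset.prod_pos fun y _ => hfp _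
  have hPpos : 0 < P := by
    have h : 0 < P * ((n * d).factorial : ℝ) := by rw [hP]; positivity
    exact pos_of_mul_pos_left h (hfp _).le
  have hPlog : Real.log P + Real.log ((n * d).factorial : ℝ) = Real.log (T.card : ℝ)
      + (∑ y, nn y * Real.log (μ y)) + (Real.log (S'.card : ℝ)
        + ∑ y, Real.log ((d * nn y).factorial : ℝ)) := by
    rw [← Real.log_mul hPpos.ne' (hfp _).ne', hP, Real.log_mul (by positivity) (by positivity),
      Real.log_mul hTpos'.ne' hμp.ne', Real.log_mul hSpos'.ne' hdp.ne',
      Real.log_prod (fun y _ => (hfp _).ne'),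
      Real.log_prod (fun y _ => (pow_pos (hμ0 y) _).ne')]
    simp only [Real.log_pow]
  -- estimates
  set B : ℝ := 1 + Real.log (((2 * K : ℕ) : ℝ) + 1) with hB
  have hup : ∀ k : ℕ, k ≤ n * d → Real.log (k.factorial : ℝ) ≤ entF k + B := by
    intro k hk
    have h1 := log_fact_upper k
    have h2 : (k:ℝ) ≤ ((2 * K : ℕ) : ℝ) := by exact_mod_cast (hK ▸ hk)
    have h3 := Real.log_le_log (by positivity : (0:ℝ) < (k:ℝ) + 1) (by linarith : (k:ℝ) + 1 ≤ ((2 * K : ℕ) : ℝ) + 1)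
    linarith
  have hnle : n ≤ n * d := Nat.le_mul_of_pos_right n hd
  have hnny : ∀ y, nn y ≤ n := by
    intro y
    calc nn y ≤ ∑ y, nn y := Finset.single_le_sum (fun _ _ => Nat.zero_le _) (Finset.mem_univ y)
      _ = n := hnsum
  have hdny : ∀ y, d * nn y ≤ n * d := by
    intro y
    rw [mul_comm n d]; exact Nat.mul_le_mul_left d (hnny y)
  have b1 := hup n hnle
  have b1' := log_fact_lower n
  have b2 := hup (n * d) le_rfl
  have b2' := log_fact_lower (n * d)
  have b3 : ∑ y, Real.log ((nn y).factorial : ℝ) ≤ ∑ y, entF (n * ρ y) + q * B := by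
    calc _ ≤ ∑ y, (entF (nn y) + B) :=
          Finset.sum_le_sum fun y _ => hup _ ((hnny y).trans hnle)
      _ = _ := by
          rw [Finset.sum_add_distrib]
          simp [hnn]
  have b3' : ∑ y, entF (n * ρ y) ≤ ∑ y, Real.log ((nn y).factorial : ℝ) := by
    refine Finset.sum_le_sum fun y _ => ?_
    rw [← hnn]; exact log_fact_lower _
  have hdn : ∀ y, ((d * nn y : ℕ) : ℝ) = (n * d) * ρ y := by
    intro y; push_cast; rw [hnn]; ring
  have b4 : ∑ y, Real.log ((d * nn y).factorial : ℝ) ≤ ∑ y, entF ((n * d) * ρ y) + q * B := by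
    calc _ ≤ ∑ y, (entF ((d * nn y : ℕ) : ℝ) + B) :=
          Finset.sum_le_sum fun y _ => hup _ (hdny y)
      _ = _ := by
          rw [Finset.sum_add_distrib]
          simp only [hdn]
          simp
  have b4' : ∑ y, entF ((n * d) * ρ y) ≤ ∑ y, Real.log ((d * nn y).factorial : ℝ) := by
    refine Finset.sum_le_sum fun y _ => ?_
    rw [← hdn]; exact log_fact_lower _
  have b5 : Real.log (S'.card : ℝ) ≤ -(K * ∑ a, ν a * Real.log (ν a)) := by
    have h := Real.log_le_log (by positivity) hSup
    rw [Real.log_mul hSpos'.ne' (Real.exp_pos _).ne', Real.log_exp, Real.log_one] at h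
    linarith
  have i1 := entF_scale ρ hρ0 hρ1 n hnpos
  have i2 := entF_scale ρ hρ0 hρ1 (n * d) (by positivity)
  have i3 := entF_scale ν hν0 hν1 K hKpos
  have b5' : -(K * ∑ a, ν a * Real.log (ν a)) - 2 * q ^ 2 * B ≤ Real.log (S'.card : ℝ) := by
    refine le_trans (le_of_eq ?_) hSlow
    rw [← neg_mul, ← i3, Fintype.sum_prod_type]
    have : ∀ y x, entF ((m y x : ℝ) / 2) = entF (K * ν (y, x)) := by
      intro y x
      rw [hm, hKr]; congr 1; ring
    simp only [this, Finset.sum_add_distrib]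
    simp
    ring
  -- target
  have t1 : -(n : ℝ) * (∑ i, ρ i * Real.log (ρ i / μ i))
      = -n * (∑ i, ρ i * Real.log (ρ i)) + ∑ y, nn y * Real.log (μ y) := by
    rw [Finset.mul_sum, Finset.mul_sum, ← Finset.sum_add_distrib]
    refine Finset.sum_congr rfl fun i _ => ?_
    rw [hnn]
    rcases (hρ0 i).eq_or_lt with h | h
    · rw [← h]; simp
    · rw [Real.log_div h.ne' (hμ0 i).ne']; ring
  have t2 : ∑ i, ∑ j, ν (i, j) * Real.log (ν (i, j) / (ρ i * ρ j))
      = ∑ a, ν a * Real.log (ν a) - 2 * ∑ i, ρ i * Real.log (ρ i) := by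
    have hle : ∀ i j, ν (i, j) ≤ ρ i := by
      intro i j
      rw [← hνρ i]
      exact Finset.single_le_sum (f := fun j => ν (i, j)) (fun _ _ => hν0 _) (Finset.mem_univ j)
    have e1 : ∀ i j, ν (i, j) * Real.log (ν (i, j) / (ρ i * ρ j))
        = ν (i, j) * Real.log (ν (i, j)) - ν (i, j) * Real.log (ρ i)
          - ν (i, j) * Real.log (ρ j) := by
      intro i j
      rcases (hν0 (i, j)).eq_or_lt with h | h
      · rw [← h]; simp
      · have hi : 0 < ρ i := h.trans_le (hle i j)
        have hj : 0 < ρ j := by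
          have := hle j i
          rw [hνs] at this
          exact h.trans_le this
        rw [Real.log_div h.ne' (mul_pos hi hj).ne', Real.log_mul hi.ne' hj.ne']; ring
    simp only [e1, Finset.sum_sub_distrib]
    have e2 : ∑ i, ∑ j, ν (i, j) * Real.log (ρ i) = ∑ i, ρ i * Real.log (ρ i) := by
      simp only [← Finset.sum_mul, hνρ]
    have e3 : ∑ i, ∑ j, ν (i, j) * Real.log (ρ j) = ∑ i, ρ i * Real.log (ρ i) := by
      rw [Finset.sum_comm, ← e2]
      refine Finset.sum_congr rfl fun i _ => Finset.sum_congr rfl fun j _ => ?_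
      rw [hνs]
    rw [e2, e3, Fintype.sum_prod_type]
    ring
  have hBle : B ≤ (1 + (1 + Real.log ((d:ℝ) + 1)) / Real.log 2) * Real.log n := by
    have h1 : Real.log (((2 * K : ℕ) : ℝ) + 1) ≤ Real.log n + Real.log ((d:ℝ) + 1) := by
      rw [← Real.log_mul hnpos.ne' (by positivity), ← hK]
      refine Real.log_le_log (by positivity) ?_
      push_cast
      linarith
    have h2 : Real.log 2 ≤ Real.log n := Real.log_le_log (by norm_num) hn2
    have h3 : (1 + Real.log ((d:ℝ) + 1)) ≤ (1 + Real.log ((d:ℝ) + 1)) / Real.log 2 * Real.log n := by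
      rw [div_mul_eq_mul_div, le_div_iff₀ hl2]
      exact mul_le_mul_of_nonneg_left h2 (by linarith)
    rw [hB]
    linarith
  have hBpos : 0 ≤ B := by
    have : 0 ≤ Real.log (((2 * K : ℕ) : ℝ) + 1) :=
      Real.log_nonneg (by linarith [Nat.cast_nonneg (α := ℝ) (2 * K)])
    linarith
  have hfinal : (1 + q + 2 * (q:ℝ) ^ 2) * B ≤ (1 + q + 2 * (q:ℝ) ^ 2)
      * (1 + (1 + Real.log ((d:ℝ) + 1)) / Real.log 2) * Real.log n := by
    rw [mul_assoc]
    exact mul_le_mul_of_nonneg_left hBle (by positivity)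
  refine le_trans ?_ hfinal
  rw [t1, t2]
  push_cast at b2 b2'
  have hq1 : 0 ≤ (q:ℝ) * B := by positivity
  have hq2 : 0 ≤ (q:ℝ) ^ 2 * B := by positivity
  have hKe : ((n:ℝ) * d) / 2 = K := by rw [hKr]; ring
  rw [hKe]
  rw [hKr] at i2 b2 b2' b4 b4'
  rw [abs_le]
  constructor <;> linarith
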